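/- Let α ∈ (1,2) and γ ∈ (α−1, α). Then the function y ↦ (|1+y|^γ − 1 − γy)/|y|^{α+1} is integrable on ℝ and c₅(α)·∫ℝ (|1+y|^γ − 1 − γy)/|y|^{α+1} dy = (γ/α)·m_γ/m_{γ−α}, where c₅(α) = α/(2Γ(1−α)cos(απ/2)) and m_β := 2^β Γ((1+β)/2) Γ((α−β)/α)/(√π Γ((2−β)/2)) for −1 < β < α. -/

import Mathlib

open MeasureTheory

/-- absolute moment `E|X₁|^β` of a standard symmetric `α`-stable variable. -/
noncomputable def stableMoment (α β : ℝ) : ℝ :=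
  2 ^ β * Real.Gamma ((1 + β) / 2) * Real.Gamma ((α - β) / α) /
    (Real.sqrt Real.pi * Real.Gamma ((2 - β) / 2))

open Set Filter Topology ProbabilityTheory

theorem integrable_comp_abs_of_integrableOn_Ioi {f : ℝ → ℝ} (hf : IntegrableOn f (Ioi 0)) :
    Integrable (fun x => f |x|) := by
  have h1 : IntegrableOn (fun x => f |x|) (Ici 0) := by
    rw [integrableOn_Ici_iff_integrableOn_Ioi]
    exact hf.congr_fun (fun x hx => by rw [abs_of_pos hx]) measurableSet_Ioi
  have h2 : IntegrableOn (fun x => f |x|) (Iic 0) := by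
    have := IntegrableOn.comp_neg_Iic (c := (0 : ℝ)) (f := fun x => f |x|) (by simpa using h1)
    simpa using this
  rw [← integrableOn_univ, ← Iic_union_Ici (a := (0 : ℝ))]
  exact h2.union h1

theorem abs_rpow_one_add_sub_le {γ y : ℝ} (h0 : 0 < γ) (h2 : γ < 2) (hy : |y| ≤ 1 / 2) :
    |(1 + y) ^ γ - 1 - γ * y| ≤ 2 * y ^ 2 := by
  obtain ⟨hy1, hy2⟩ := abs_le.mp hy
  have hpos : 0 < 1 + y := by linarith
  rw [abs_le]
  rcases le_total 1 γ with h | h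
  · have hl := one_add_mul_self_le_rpow_one_add (s := y) (by linarith) h
    have hu := rpow_one_add_le_one_add_mul_self (s := y) (p := γ - 1) (by linarith)
      (by linarith) (by linarith)
    have he : (1 + y) ^ γ = (1 + y) * (1 + y) ^ (γ - 1) := by
      rw [Real.rpow_sub_one hpos.ne']; field_simp
    rw [he] at hl ⊢
    constructor <;> nlinarith [sq_nonneg y, mul_le_mul_of_nonneg_left hu hpos.le]
  · have hu := rpow_one_add_le_one_add_mul_self (s := y) (p := γ) (by linarith) h0.le h
    have hl := one_add_mul_self_le_rpow_one_add (s := y) (p := γ + 1) (by linarith) (by linarith)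
    rw [Real.rpow_add_one hpos.ne'] at hl
    constructor
    · have : -(2 * y ^ 2) * (1 + y) ≤ ((1 + y) ^ γ - 1 - γ * y) * (1 + y) := by
        nlinarith [sq_nonneg y, mul_nonneg (sq_nonneg y) (by linarith : (0:ℝ) ≤ y + 1 / 2),
          mul_nonneg (sq_nonneg y) (sub_nonneg.2 h)]
      exact le_of_mul_le_mul_right this hpos
    · nlinarith [sq_nonneg y]

theorem abs_rpow_abs_one_add_sub_le {γ y : ℝ} (h0 : 0 < γ) (h2 : γ < 2) (hy : 1 / 2 < |y|) :
    |(|1 + y| ^ γ - 1 - γ * y)| ≤ 9 * |y| ^ γ + 4 * |y| := by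
  have h3 : |1 + y| ≤ 3 * |y| := by
    have := abs_add_le 1 y
    simp only [abs_one] at this; linarith
  have h4 : |1 + y| ^ γ ≤ 9 * |y| ^ γ := by
    calc |1 + y| ^ γ ≤ (3 * |y|) ^ γ := Real.rpow_le_rpow (abs_nonneg _) h3 h0.le
      _ = 3 ^ γ * |y| ^ γ := Real.mul_rpow (by norm_num) (abs_nonneg _)
      _ ≤ 3 ^ (2:ℝ) * |y| ^ γ := by gcongr; norm_num
      _ = 9 * |y| ^ γ := by norm_num
  have h5 : |γ * y| ≤ 2 * |y| := by rw [abs_mul, abs_of_pos h0]; gcongr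
  have h6 : 0 ≤ |1 + y| ^ γ := by positivity
  obtain ⟨h7, h8⟩ := abs_le.mp h5
  have h9 : 0 ≤ |y| ^ γ := by positivity
  rw [abs_le]; constructor <;> linarith

theorem integrable_compensated_abs_rpow {α γ : ℝ} (hα : α ∈ Ioo (1:ℝ) 2) (hγ : γ ∈ Ioo (α - 1) α) :
    Integrable (fun y : ℝ => (|1 + y| ^ γ - 1 - γ * y) / |y| ^ (α + 1)) := by
  obtain ⟨hα1, hα2⟩ := hα
  obtain ⟨hγ1, hγ2⟩ := hγ
  have h0 : 0 < γ := by linarith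
  let b : ℝ → ℝ := fun t => if t ≤ 1 / 2 then 2 * t ^ (1 - α) else
    9 * t ^ (γ - (α + 1)) + 4 * t ^ (-α)
  have hb : IntegrableOn b (Ioi 0) := by
    rw [← Ioc_union_Ioi_eq_Ioi (by norm_num : (0:ℝ) ≤ 1 / 2)]
    refine IntegrableOn.union ?_ ?_
    · have h : IntegrableOn (fun t : ℝ => 2 * t ^ (1 - α)) (Ioc 0 (1 / 2)) := by
        rw [integrableOn_Ioc_iff_integrableOn_Ioo]
        exact ((intervalIntegral.integrableOn_Ioo_rpow_iff (by norm_num)).2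
          (by linarith)).const_mul 2
      exact h.congr_fun (fun t ht => by simp only [b, if_pos ht.2]) measurableSet_Ioc
    · have h : IntegrableOn (fun t : ℝ => 9 * t ^ (γ - (α + 1)) + 4 * t ^ (-α)) (Ioi (1 / 2)) :=
        ((integrableOn_Ioi_rpow_of_lt (by linarith) (by norm_num)).const_mul 9).add
          ((integrableOn_Ioi_rpow_of_lt (by linarith) (by norm_num)).const_mul 4)
      exact h.congr_fun (fun t ht => by simp only [b, if_neg (not_le.2 (mem_Ioi.1 ht))])
        measurableSet_Ioi
  refine (integrable_comp_abs_of_integrableOn_Ioi hb).mono'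
    (Measurable.aestronglyMeasurable (by fun_prop)) ?_
  filter_upwards [Measure.ae_ne volume 0] with y hy
  have hy0 : 0 < |y| := abs_pos.2 hy
  have hw : 0 < |y| ^ (α + 1) := by positivity
  rw [Real.norm_eq_abs, abs_div, abs_of_pos hw, div_le_iff₀ hw]
  rcases le_or_gt |y| (1 / 2) with h | h
  · have h1 : 0 < 1 + y := by linarith [(abs_le.1 h).1]
    simp only [b, if_pos h]
    rw [mul_assoc, ← Real.rpow_add hy0, abs_of_pos h1]
    have : |y| ^ (1 - α + (α + 1)) = y ^ 2 := by
      rw [← sq_abs, ← Real.rpow_natCast]; congr 1; push_cast; ring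
    rw [this]
    exact abs_rpow_one_add_sub_le h0 (by linarith) h
  · simp only [b, if_neg (not_le.2 h)]
    rw [add_mul, mul_assoc, mul_assoc, ← Real.rpow_add hy0, ← Real.rpow_add hy0]
    have e1 : γ - (α + 1) + (α + 1) = γ := by ring
    have e2 : -α + (α + 1) = 1 := by ring
    rw [e1, e2, Real.rpow_one]
    exact abs_rpow_abs_one_add_sub_le h0 (by linarith) h

theorem integrableOn_and_integral_rpow_mul_one_add_rpow {q r : ℝ} (hq : 0 < q) (hqr : q < r) :
    IntegrableOn (fun t : ℝ => t ^ (q - 1) * (1 + t) ^ (-r)) (Ioi 0) ∧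
    ∫ t in Ioi (0:ℝ), t ^ (q - 1) * (1 + t) ^ (-r) =
      Real.Gamma q * Real.Gamma (r - q) / Real.Gamma r := by
  have hr : 0 < r := hq.trans hqr
  have hΓ : 0 < Real.Gamma r := Real.Gamma_pos_of_pos hr
  let F : ℝ → ℝ → ℝ := fun u t => (u ^ (r - 1) * Real.exp (-u)) * (t ^ (q - 1) * Real.exp (-(u * t)))
  have hin : ∀ u ∈ Ioi (0:ℝ), ∫ t in Ioi (0:ℝ), F u t =
      Real.Gamma q * (u ^ (r - q - 1) * Real.exp (-u)) := by
    intro u hu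
    rw [integral_const_mul, Real.integral_rpow_mul_exp_neg_mul_Ioi hq hu,
      one_div, Real.inv_rpow (le_of_lt hu), show r - q - 1 = r - 1 - q by ring,
      Real.rpow_sub hu (r - 1) q]
    ring
  have hout : ∀ t ∈ Ioi (0:ℝ), ∫ u in Ioi (0:ℝ), F u t =
      Real.Gamma r * (t ^ (q - 1) * (1 + t) ^ (-r)) := by
    intro t ht
    have ht' : 0 < 1 + t := by linarith [mem_Ioi.1 ht]
    have : ∀ u, F u t = t ^ (q - 1) * (u ^ (r - 1) * Real.exp (-((1 + t) * u))) := by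
      intro u
      simp only [F]
      rw [show -((1 + t) * u) = -u + -(u * t) by ring, Real.exp_add]; ring
    simp_rw [this]
    rw [integral_const_mul, Real.integral_rpow_mul_exp_neg_mul_Ioi hr ht', one_div,
      Real.inv_rpow ht'.le, Real.rpow_neg ht'.le]
    ring
  have hint : Integrable (Function.uncurry F)
      ((volume.restrict (Ioi 0)).prod (volume.restrict (Ioi 0))) := by
    rw [integrable_prod_iff (Measurable.aestronglyMeasurable (by fun_prop))]
    constructor
    · filter_upwards [ae_restrict_mem measurableSet_Ioi] with u hu
      have := integrableOn_rpow_mul_exp_neg_mul_rpow (p := 1) (s := q - 1) (b := u)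
        (by linarith) one_pos hu
      refine (this.const_mul (u ^ (r - 1) * Real.exp (-u))).congr (ae_of_all _ fun t => ?_)
      simp [F]
    · have := ((Real.GammaIntegral_convergent (s := r - q) (by linarith)).const_mul (Real.Gamma q))
      refine this.congr ?_
      filter_upwards [ae_restrict_mem measurableSet_Ioi] with u hu
      rw [mul_comm (Real.exp _), ← hin u hu]
      refine setIntegral_congr_fun measurableSet_Ioi fun t ht => ?_
      have hu' : 0 < u := hu
      have ht' : 0 < t := ht
      exact (Real.norm_of_nonneg (by positivity)).symm
  have hi2 := hint.integral_prod_right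
  constructor
  · refine ((hi2.const_mul (Real.Gamma r)⁻¹).congr ?_)
    filter_upwards [ae_restrict_mem measurableSet_Ioi] with t ht
    simp only [Function.uncurry]
    rw [hout t ht]; field_simp
  · have hsw := integral_integral_swap hint
    rw [setIntegral_congr_fun measurableSet_Ioi hin, setIntegral_congr_fun measurableSet_Ioi hout,
      integral_const_mul, integral_const_mul] at hsw
    have hG : ∫ u in Ioi (0:ℝ), u ^ (r - q - 1) * Real.exp (-u) = Real.Gamma (r - q) := by
      rw [Real.Gamma_eq_integral (by linarith)]; simp_rw [mul_comm]
    rw [hG] at hsw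
    field_simp
    linarith
theorem integral_rpow_mul_one_add_inv_rpow_sub_one {a p : ℝ} (hp : 0 < p) (hpa : p < a)
    (ha : a < 1) :
    ∫ t in Ioi (0:ℝ), t ^ (a - 1) * ((1 + t⁻¹) ^ p - 1) =
      p / a * (Real.Gamma (1 - a) * Real.Gamma (a - p) / Real.Gamma (1 - p)) := by
  have ha0 : 0 < a := hp.trans hpa
  obtain ⟨hbi, hb⟩ := integrableOn_and_integral_rpow_mul_one_add_rpow (q := a - p) (r := 1 - p)
    (by linarith) (by linarith)
  let u : ℝ → ℝ := fun t => (1 + t⁻¹) ^ p - 1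
  let u' : ℝ → ℝ := fun t => -(t ^ 2)⁻¹ * p * (1 + t⁻¹) ^ (p - 1)
  let v : ℝ → ℝ := fun t => t ^ a / a
  let v' : ℝ → ℝ := fun t => t ^ (a - 1)
  have hu0 : ∀ t, 0 < t → 0 ≤ u t := fun t ht => by
    have := Real.one_le_rpow (x := 1 + t⁻¹) (by linarith [inv_pos.2 ht]) hp.le
    simp only [u]; linarith
  have hu_large : ∀ t, 0 < t → u t ≤ t⁻¹ := fun t ht => by
    have hi := inv_pos.2 ht
    have := rpow_one_add_le_one_add_mul_self (s := t⁻¹) (p := p) (by linarith) hp.le (by linarith)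
    simp only [u]; nlinarith
  have hu_small : ∀ t, 0 < t → t ≤ 1 → u t ≤ 2 * t ^ (-p) := fun t ht ht1 => by
    have hi : 1 ≤ t⁻¹ := (one_le_inv₀ ht).2 ht1
    have h1 : (1 + t⁻¹) ^ p ≤ (2 * t⁻¹) ^ p :=
      Real.rpow_le_rpow (by linarith) (by linarith) hp.le
    have h2 : (2:ℝ) ^ p ≤ 2 := by
      calc (2:ℝ) ^ p ≤ 2 ^ (1:ℝ) := Real.rpow_le_rpow_of_exponent_le (by norm_num) (by linarith)
        _ = 2 := by norm_num
    rw [Real.mul_rpow (by norm_num) (by linarith), Real.inv_rpow ht.le, ← Real.rpow_neg ht.le] at h1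
    have h3 : 0 < t ^ (-p) := by positivity
    simp only [u]; nlinarith
  have hdu : ∀ t ∈ Ioi (0:ℝ), HasDerivAt u (u' t) t := fun t ht => by
    have ht : 0 < t := ht
    have h1 := ((hasDerivAt_inv ht.ne').const_add 1).rpow_const (p := p)
      (Or.inl (by positivity : (1 + t⁻¹) ≠ 0))
    exact h1.sub_const 1
  have hdv : ∀ t ∈ Ioi (0:ℝ), HasDerivAt v (v' t) t := fun t ht => by
    have ht : 0 < t := ht
    have h1 := (Real.hasDerivAt_rpow_const (p := a) (Or.inl ht.ne')).div_const a
    refine h1.congr_deriv ?_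
    change _ = t ^ (a - 1)
    field_simp
  have hu'v : ∀ t ∈ Ioi (0:ℝ), u' t * v t =
      -(p / a) * (t ^ (a - p - 1) * (1 + t) ^ (-(1 - p))) := fun t ht => by
    have ht : 0 < t := ht
    have e : 1 + t⁻¹ = (1 + t) * t⁻¹ := by field_simp; ring
    simp only [u', v]
    rw [e, Real.mul_rpow (by positivity) (by positivity), Real.inv_rpow ht.le,
      show a - p - 1 = a - (p - 1) - 2 by ring, Real.rpow_sub ht (a - (p - 1)) 2,
      Real.rpow_sub ht a (p - 1),
      show -(1 - p) = p - 1 by ring, Real.rpow_two]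
    field_simp
  have huv' : IntegrableOn (u * v') (Ioi 0) := by
    have hm : AEStronglyMeasurable (u * v') volume := by
      apply Measurable.aestronglyMeasurable
      simp only [u, v']; fun_prop
    rw [← Ioc_union_Ioi_eq_Ioi zero_le_one]
    refine IntegrableOn.union ?_ ?_
    · have h : IntegrableOn (fun t : ℝ => 2 * t ^ (a - p - 1)) (Ioc 0 1) := by
        rw [integrableOn_Ioc_iff_integrableOn_Ioo]
        exact ((intervalIntegral.integrableOn_Ioo_rpow_iff (by norm_num)).2
          (by linarith)).const_mul 2
      refine h.mono' hm.restrict ?_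
      filter_upwards [ae_restrict_mem measurableSet_Ioc] with t ht
      have ht0 : 0 < t := ht.1
      simp only [Pi.mul_apply, v']
      rw [norm_mul, Real.norm_of_nonneg (hu0 t ht0), Real.norm_of_nonneg (by positivity),
        show a - p - 1 = -p + (a - 1) by ring, Real.rpow_add ht0, ← mul_assoc]
      gcongr
      exact hu_small t ht0 ht.2
    · have h := integrableOn_Ioi_rpow_of_lt (a := a - 2) (by linarith) zero_lt_one
      refine h.mono' hm.restrict ?_
      filter_upwards [ae_restrict_mem measurableSet_Ioi] with t ht
      have ht0 : 0 < t := zero_lt_one.trans ht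
      simp only [Pi.mul_apply, v']
      rw [norm_mul, Real.norm_of_nonneg (hu0 t ht0), Real.norm_of_nonneg (by positivity),
        show a - 2 = -1 + (a - 1) by ring, Real.rpow_add ht0, Real.rpow_neg_one]
      gcongr
      exact hu_large t ht0
  have hu'v_int : IntegrableOn (u' * v) (Ioi 0) :=
    IntegrableOn.congr_fun (hbi.const_mul (-(p / a))) (fun t ht => (hu'v t ht).symm)
      measurableSet_Ioi
  have hlim0 : Tendsto (u * v) (𝓝[>] 0) (𝓝 0) := by
    have h : Tendsto (fun t : ℝ => 2 / a * t ^ (a - p)) (𝓝[>] 0) (𝓝 0) := by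
      have h1 : Tendsto (fun t : ℝ => 2 / a * t ^ (a - p)) (𝓝 0) (𝓝 (2 / a * 0 ^ (a - p))) :=
        ((Real.continuousAt_rpow_const 0 (a - p) (Or.inr (by linarith))).tendsto).const_mul _
      rw [Real.zero_rpow (by linarith), mul_zero] at h1
      exact h1.mono_left nhdsWithin_le_nhds
    refine tendsto_of_tendsto_of_tendsto_of_le_of_le' tendsto_const_nhds h ?_ ?_
    · filter_upwards [self_mem_nhdsWithin] with t ht
      have ht0 : 0 < t := ht
      exact mul_nonneg (hu0 t ht0) (by positivity)
    · filter_upwards [Ioo_mem_nhdsGT (zero_lt_one (α := ℝ))] with t ht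
      have ht0 : 0 < t := ht.1
      calc u t * v t ≤ 2 * t ^ (-p) * (t ^ a / a) := by
            simp only [v]; gcongr; exact hu_small t ht0 ht.2.le
        _ = 2 / a * t ^ (a - p) := by
            rw [show a - p = -p + a by ring, Real.rpow_add ht0]; ring
  have hlimtop : Tendsto (u * v) atTop (𝓝 0) := by
    have h : Tendsto (fun t : ℝ => 1 / a * t ^ (-(1 - a))) atTop (𝓝 0) := by
      simpa using (tendsto_rpow_neg_atTop (by linarith : 0 < 1 - a)).const_mul (1 / a)
    refine tendsto_of_tendsto_of_tendsto_of_le_of_le' tendsto_const_nhds h ?_ ?_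
    · filter_upwards [eventually_gt_atTop 0] with t ht0
      exact mul_nonneg (hu0 t ht0) (by positivity)
    · filter_upwards [eventually_gt_atTop 0] with t ht0
      calc u t * v t ≤ t⁻¹ * (t ^ a / a) := by
            simp only [v]; gcongr; exact hu_large t ht0
        _ = 1 / a * t ^ (-(1 - a)) := by
            rw [show -(1 - a) = -1 + a by ring, Real.rpow_add ht0, Real.rpow_neg_one]; ring
  have key := integral_Ioi_mul_deriv_eq_deriv_mul hdu hdv huv' hu'v_int hlim0 hlimtop
  rw [setIntegral_congr_fun measurableSet_Ioi hu'v, integral_const_mul, hb,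
    show 1 - p - (a - p) = 1 - a by ring] at key
  simp_rw [mul_comm (_ ^ (a - 1))]
  rw [key]; ring

theorem integral_abs_rpow_gaussianReal {v : NNReal} (hv : v ≠ 0) {β : ℝ} (hβ : -1 < β) :
    ∫ x, |x| ^ β ∂(gaussianReal 0 v) =
      (2 * v : ℝ) ^ (β / 2) * Real.Gamma ((β + 1) / 2) / Real.sqrt Real.pi := by
  have hv0 : (0:ℝ) < v := by positivity
  rw [integral_gaussianReal_eq_integral_smul hv]
  let f : ℝ → ℝ := fun t =>
    (√(2 * Real.pi * v))⁻¹ * (t ^ β * Real.exp (-(2 * v : ℝ)⁻¹ * t ^ (2:ℝ)))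
  have h1 : ∀ x : ℝ, gaussianPDFReal 0 v x • |x| ^ β = f |x| := by
    intro x
    simp only [f, gaussianPDFReal, smul_eq_mul, sub_zero, Real.rpow_two, sq_abs]
    rw [show -x ^ 2 / (2 * (v:ℝ)) = -(2 * v : ℝ)⁻¹ * x ^ 2 by field_simp]
    ring
  rw [integral_congr_ae (ae_of_all _ h1), integral_comp_abs, integral_const_mul,
    integral_rpow_mul_exp_neg_mul_rpow (by norm_num) hβ (by positivity),
    Real.inv_rpow (by positivity), ← Real.rpow_neg (by positivity),
    show -(-(β + 1) / 2) = β / 2 + 1 / 2 by ring, Real.rpow_add (by positivity),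
    ← Real.sqrt_eq_rpow, show 2 * Real.pi * (v:ℝ) = (2 * v) * Real.pi by ring,
    Real.sqrt_mul (by positivity)]
  have : 0 < √(2 * (v:ℝ)) := by positivity
  field_simp

theorem integrable_abs_rpow_gaussianReal {v : NNReal} (hv : v ≠ 0) {β : ℝ} (hβ : -1 < β) :
    Integrable (fun x : ℝ => |x| ^ β) (gaussianReal 0 v) := by
  by_contra h
  have h1 := integral_abs_rpow_gaussianReal hv hβ
  rw [integral_undef h] at h1
  have hv0 : (0:ℝ) < v := by positivity
  have hΓ := Real.Gamma_pos_of_pos (by linarith : 0 < (β + 1) / 2)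
  have : 0 < (2 * v : ℝ) ^ (β / 2) * Real.Gamma ((β + 1) / 2) / Real.sqrt Real.pi := by positivity
  linarith

theorem integral_rpow_mul_gaussianPDFReal_inv {α y : ℝ} (hα : 0 < α) (hy : y ≠ 0) :
    ∫ t in Ioi (0:ℝ), t ^ (α / 2 - 1) * gaussianPDFReal 0 (Real.toNNReal t⁻¹) y =
      2 ^ (α / 2) * Real.Gamma ((α + 1) / 2) / √Real.pi * (|y| ^ (α + 1))⁻¹ := by
  have hy2 : 0 < |y| := abs_pos.2 hy
  have h1 : ∀ t ∈ Ioi (0:ℝ), t ^ (α / 2 - 1) * gaussianPDFReal 0 (Real.toNNReal t⁻¹) y =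
      (√(2 * Real.pi))⁻¹ * (t ^ ((α + 1) / 2 - 1) * Real.exp (-(|y| ^ 2 / 2 * t))) := by
    intro t ht
    have ht0 : 0 < t := ht
    simp only [gaussianPDFReal, sub_zero, Real.coe_toNNReal _ (inv_pos.2 ht0).le]
    rw [show (α + 1) / 2 - 1 = (α / 2 - 1) + 1 / 2 by ring, Real.rpow_add ht0,
      ← Real.sqrt_eq_rpow, Real.sqrt_mul (by positivity), Real.sqrt_inv, sq_abs,
      show -y ^ 2 / (2 * t⁻¹) = -(y ^ 2 / 2 * t) by field_simp]
    field_simp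
  rw [setIntegral_congr_fun measurableSet_Ioi h1, integral_const_mul,
    Real.integral_rpow_mul_exp_neg_mul_Ioi (by linarith) (by positivity), one_div_div,
    Real.div_rpow (by norm_num) (by positivity), ← Real.rpow_natCast, ← Real.rpow_mul hy2.le,
    show ((2:ℕ):ℝ) * ((α + 1) / 2) = α + 1 by push_cast; ring,
    show (α + 1) / 2 = α / 2 + 1 / 2 by ring, Real.rpow_add two_pos, ← Real.sqrt_eq_rpow,
    Real.sqrt_mul (by norm_num)]
  field_simp

/-- The symmetrised increment `(|x + y|^γ + |x - y|^γ) / 2 - |x|^γ` of the power function. -/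
noncomputable def symmIncrement (γ x y : ℝ) : ℝ :=
  (|x + y| ^ γ + |x - y| ^ γ) / 2 - |x| ^ γ

@[fun_prop]
theorem measurable_symmIncrement (γ : ℝ) :
    Measurable (fun z : ℝ × ℝ => symmIncrement γ z.1 z.2) := by
  unfold symmIncrement; fun_prop

theorem integrable_and_integral_symmIncrement_one {α γ : ℝ} (hα : α ∈ Ioo (1:ℝ) 2)
    (hγ : γ ∈ Ioo (α - 1) α) :
    Integrable (fun y => symmIncrement γ 1 y * (|y| ^ (α + 1))⁻¹) ∧
      ∫ y, symmIncrement γ 1 y * (|y| ^ (α + 1))⁻¹ =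
        ∫ y : ℝ, (|1 + y| ^ γ - 1 - γ * y) / |y| ^ (α + 1) := by
  have hi := integrable_compensated_abs_rpow hα hγ
  have hsum : (fun y => symmIncrement γ 1 y * (|y| ^ (α + 1))⁻¹) = fun y =>
      ((|1 + y| ^ γ - 1 - γ * y) / |y| ^ (α + 1) +
        (|1 + -y| ^ γ - 1 - γ * -y) / |-y| ^ (α + 1)) / 2 := by
    funext y
    simp only [symmIncrement, abs_neg, abs_one, Real.one_rpow, ← sub_eq_add_neg]
    ring
  rw [hsum]
  refine ⟨(hi.add hi.comp_neg).div_const 2, ?_⟩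
  rw [integral_div, integral_add hi hi.comp_neg,
    integral_neg_eq_self (fun y : ℝ => (|1 + y| ^ γ - 1 - γ * y) / |y| ^ (α + 1))]
  ring

theorem symmIncrement_mul_eq_scale (α γ : ℝ) {x : ℝ} (hx : x ≠ 0) (y : ℝ) :
    symmIncrement γ x y * (|y| ^ (α + 1))⁻¹ = |x| ^ (γ - (α + 1)) *
      (symmIncrement γ 1 (x⁻¹ * y) * (|x⁻¹ * y| ^ (α + 1))⁻¹) := by
  have hx0 : 0 < |x| := abs_pos.2 hx
  have e1 : |1 + x⁻¹ * y| = |x|⁻¹ * |x + y| := by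
    rw [← abs_inv, ← abs_mul]; congr 1; field_simp
  have e2 : |1 - x⁻¹ * y| = |x|⁻¹ * |x - y| := by
    rw [← abs_inv, ← abs_mul]; congr 1; field_simp
  simp only [symmIncrement, e1, e2, abs_mul, abs_inv, abs_one, Real.one_rpow]
  rw [Real.mul_rpow (by positivity) (by positivity), Real.mul_rpow (by positivity) (by positivity),
    Real.mul_rpow (by positivity) (by positivity), Real.inv_rpow hx0.le, Real.inv_rpow hx0.le,
    Real.rpow_sub hx0]
  have h1 : 0 < |x| ^ γ := by positivity
  have h2 : 0 < |x| ^ (α + 1) := by positivity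
  rw [mul_inv]
  field_simp

theorem ae_ne_zero_gaussianReal {v : NNReal} (hv : v ≠ 0) : ∀ᵐ x ∂(gaussianReal 0 v), x ≠ 0 :=
  (gaussianReal_absolutelyContinuous 0 hv).ae_le (Measure.ae_ne volume 0)

theorem integrable_symmIncrement_prod {α γ : ℝ} (hα : α ∈ Ioo (1:ℝ) 2) (hγ : γ ∈ Ioo (α - 1) α) :
    Integrable (Function.uncurry fun x y => symmIncrement γ x y * (|y| ^ (α + 1))⁻¹)
      ((gaussianReal 0 1).prod volume) := by
  obtain ⟨hi, -⟩ := integrable_and_integral_symmIncrement_one hα hγ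
  rw [integrable_prod_iff (Measurable.aestronglyMeasurable
    (by unfold Function.uncurry; fun_prop))]
  constructor
  · filter_upwards [ae_ne_zero_gaussianReal one_ne_zero] with x hx
    simp only [Function.uncurry, symmIncrement_mul_eq_scale α γ hx]
    exact (hi.comp_mul_left' (inv_ne_zero hx)).const_mul _
  · refine ((integrable_abs_rpow_gaussianReal one_ne_zero (β := γ - α)
      (by linarith [hγ.1])).mul_const
        (∫ y, ‖symmIncrement γ 1 y * (|y| ^ (α + 1))⁻¹‖)).congr ?_
    filter_upwards [ae_ne_zero_gaussianReal one_ne_zero] with x hx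
    have hx0 : 0 < |x| := abs_pos.2 hx
    simp only [Function.uncurry, symmIncrement_mul_eq_scale α γ hx]
    simp_rw [norm_mul (|x| ^ (γ - (α + 1)))]
    rw [integral_const_mul, Measure.integral_comp_mul_left
      (fun y => ‖symmIncrement γ 1 y * (|y| ^ (α + 1))⁻¹‖), inv_inv, smul_eq_mul, ← mul_assoc,
      Real.norm_of_nonneg (by positivity)]
    nth_rewrite 3 [← Real.rpow_one |x|]
    rw [← Real.rpow_add hx0]
    ring_nf

theorem integral_integral_symmIncrement {α γ : ℝ} :
    ∫ x, (∫ y, symmIncrement γ x y * (|y| ^ (α + 1))⁻¹) ∂(gaussianReal 0 1) =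
      (∫ x, |x| ^ (γ - α) ∂(gaussianReal 0 1)) *
        ∫ y, symmIncrement γ 1 y * (|y| ^ (α + 1))⁻¹ := by
  rw [← integral_mul_const]
  refine integral_congr_ae ?_
  filter_upwards [ae_ne_zero_gaussianReal one_ne_zero] with x hx
  have hx0 : 0 < |x| := abs_pos.2 hx
  simp only [symmIncrement_mul_eq_scale α γ hx]
  rw [integral_const_mul, Measure.integral_comp_mul_left
    (fun y => symmIncrement γ 1 y * (|y| ^ (α + 1))⁻¹), inv_inv, smul_eq_mul, ← mul_assoc]
  nth_rewrite 2 [← Real.rpow_one |x|]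
  rw [← Real.rpow_add hx0]
  ring_nf

theorem integral_symmIncrement_gaussianReal {γ : ℝ} (hγ : -1 < γ) {v : NNReal} :
    ∫ y, ∫ x, symmIncrement γ x y ∂(gaussianReal 0 1) ∂(gaussianReal 0 v) =
      (∫ x, |x| ^ γ ∂(gaussianReal 0 1)) * ((1 + v : ℝ) ^ (γ / 2) - 1) := by
  have hv1 : (1 + v : NNReal) ≠ 0 := by positivity
  have hconv : ((gaussianReal 0 1).prod (gaussianReal 0 v)).map (fun z => z.1 + z.2) =
      gaussianReal 0 (1 + v) := by
    have := gaussianReal_conv_gaussianReal (m₁ := 0) (m₂ := 0) (v₁ := 1) (v₂ := v)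
    rwa [add_zero] at this
  have hneg : MeasurePreserving (fun y : ℝ => -y) (gaussianReal 0 v) (gaussianReal 0 v) :=
    ⟨measurable_neg, by simpa using gaussianReal_map_neg (μ := 0) (v := v)⟩
  have hadd : MeasurePreserving (fun z : ℝ × ℝ => z.1 + z.2)
      ((gaussianReal 0 1).prod (gaussianReal 0 v)) (gaussianReal 0 (1 + v)) :=
    ⟨by fun_prop, hconv⟩
  have hsub : MeasurePreserving (fun z : ℝ × ℝ => z.1 - z.2)
      ((gaussianReal 0 1).prod (gaussianReal 0 v)) (gaussianReal 0 (1 + v)) := by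
    have := hadd.comp ((MeasurePreserving.id (gaussianReal 0 1)).prod hneg)
    simpa [Function.comp_def, Prod.map, sub_eq_add_neg] using this
  have hfst : MeasurePreserving (fun z : ℝ × ℝ => z.1)
      ((gaussianReal 0 1).prod (gaussianReal 0 v)) (gaussianReal 0 1) := measurePreserving_fst
  have hm : Measurable (fun x : ℝ => |x| ^ γ) := by fun_prop
  have hI := integrable_abs_rpow_gaussianReal hv1 hγ
  have hI1 : Integrable (fun z : ℝ × ℝ => |z.1 + z.2| ^ γ)
      ((gaussianReal 0 1).prod (gaussianReal 0 v)) :=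
    hadd.integrable_comp_of_integrable hI
  have hI2 : Integrable (fun z : ℝ × ℝ => |z.1 - z.2| ^ γ)
      ((gaussianReal 0 1).prod (gaussianReal 0 v)) :=
    hsub.integrable_comp_of_integrable hI
  have hI3 : Integrable (fun z : ℝ × ℝ => |z.1| ^ γ)
      ((gaussianReal 0 1).prod (gaussianReal 0 v)) :=
    hfst.integrable_comp_of_integrable (integrable_abs_rpow_gaussianReal one_ne_zero hγ)
  have hE : ∀ {f : ℝ × ℝ → ℝ} {u : NNReal} (_ : MeasurePreserving f
      ((gaussianReal 0 1).prod (gaussianReal 0 v)) (gaussianReal 0 u)),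
      ∫ z, |f z| ^ γ ∂((gaussianReal 0 1).prod (gaussianReal 0 v)) =
        ∫ x, |x| ^ γ ∂(gaussianReal 0 u) := fun {f u} hf => by
    rw [← hf.map_eq, integral_map hf.measurable.aemeasurable hm.aestronglyMeasurable]
  have hI12 : Integrable (fun z : ℝ × ℝ => (|z.1 + z.2| ^ γ + |z.1 - z.2| ^ γ) / 2)
      ((gaussianReal 0 1).prod (gaussianReal 0 v)) := (hI1.add hI2).div_const 2
  have htot : Integrable (Function.uncurry (symmIncrement γ))
      ((gaussianReal 0 1).prod (gaussianReal 0 v)) := hI12.sub hI3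
  have hprod := integral_prod _ htot
  simp only [Function.uncurry_apply_pair] at hprod
  rw [← integral_integral_swap htot, ← hprod]
  have hfun : Function.uncurry (symmIncrement γ) = fun z : ℝ × ℝ =>
      (|z.1 + z.2| ^ γ + |z.1 - z.2| ^ γ) / 2 - |z.1| ^ γ := by
    funext z; rfl
  rw [hfun, integral_sub hI12 hI3, integral_div, integral_add hI1 hI2]
  rw [hE hadd, hE hsub, hE hfst, integral_abs_rpow_gaussianReal hv1 hγ,
    integral_abs_rpow_gaussianReal one_ne_zero hγ]
  push_cast
  rw [Real.mul_rpow (by norm_num) (by positivity), mul_one]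
  ring

theorem integral_mul_inv_abs_rpow_eq {α : ℝ} (hα : 0 < α) {H : ℝ → ℝ} (hH : StronglyMeasurable H)
    (hHi : Integrable (fun y => H y * (|y| ^ (α + 1))⁻¹)) :
    2 ^ (α / 2) * Real.Gamma ((α + 1) / 2) / √Real.pi * ∫ y, H y * (|y| ^ (α + 1))⁻¹ =
      ∫ t in Ioi (0:ℝ), t ^ (α / 2 - 1) * ∫ y, H y ∂(gaussianReal 0 (Real.toNNReal t⁻¹)) := by
  set K : ℝ := 2 ^ (α / 2) * Real.Gamma ((α + 1) / 2) / √Real.pi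
  have hΓ := Real.Gamma_pos_of_pos (by linarith : 0 < (α + 1) / 2)
  have hK : 0 < K := by positivity
  let k : ℝ → ℝ → ℝ := fun y t => t ^ (α / 2 - 1) * gaussianPDFReal 0 (Real.toNNReal t⁻¹) y
  have hk : ∀ y, y ≠ 0 → ∫ t in Ioi (0:ℝ), k y t = K * (|y| ^ (α + 1))⁻¹ := fun y hy =>
    integral_rpow_mul_gaussianPDFReal_inv hα hy
  have hk0 : ∀ y t, t ∈ Ioi (0:ℝ) → 0 ≤ k y t := fun y t ht =>
    mul_nonneg (Real.rpow_nonneg (le_of_lt ht) _) (gaussianPDFReal_nonneg _ _ _)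
  have hki : ∀ y, y ≠ 0 → Integrable (k y) (volume.restrict (Ioi 0)) := fun y hy => by
    by_contra h
    have h1 := hk y hy
    rw [integral_undef h] at h1
    have : 0 < |y| := abs_pos.2 hy
    have : 0 < K * (|y| ^ (α + 1))⁻¹ := by positivity
    linarith
  have hkm : Measurable (Function.uncurry k) := by
    simp only [k, gaussianPDFReal, Function.uncurry_def]
    fun_prop
  have hint : Integrable (Function.uncurry fun y t => H y * k y t)
      (volume.prod (volume.restrict (Ioi 0))) := by
    have hm : Measurable (Function.uncurry fun y t => H y * k y t) :=
      (hH.measurable.comp measurable_fst).mul hkm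
    rw [integrable_prod_iff hm.aestronglyMeasurable]
    constructor
    · filter_upwards [Measure.ae_ne volume 0] with y hy
      exact (hki y hy).const_mul (H y)
    · refine (hHi.norm.const_mul K).congr ?_
      filter_upwards [Measure.ae_ne volume 0] with y hy
      have h1 : ∀ t ∈ Ioi (0:ℝ), ‖H y * k y t‖ = ‖H y‖ * k y t := fun t ht => by
        rw [norm_mul, Real.norm_of_nonneg (hk0 y t ht)]
      simp only [Function.uncurry]
      rw [setIntegral_congr_fun measurableSet_Ioi h1, integral_const_mul, hk y hy, norm_mul,
        Real.norm_of_nonneg (r := (|y| ^ (α + 1))⁻¹) (by positivity)]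
      ring
  have hsw := integral_integral_swap hint
  have hl : ∫ y, ∫ t in Ioi (0:ℝ), H y * k y t = K * ∫ y, H y * (|y| ^ (α + 1))⁻¹ := by
    rw [← integral_const_mul]
    refine integral_congr_ae ?_
    filter_upwards [Measure.ae_ne volume 0] with y hy
    rw [integral_const_mul, hk y hy]; ring
  rw [← hl, hsw]
  refine setIntegral_congr_fun measurableSet_Ioi fun t ht => ?_
  have hv : Real.toNNReal t⁻¹ ≠ 0 := (Real.toNNReal_pos.2 (inv_pos.2 ht)).ne'
  simp only [k]
  rw [integral_gaussianReal_eq_integral_smul hv, ← integral_const_mul]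
  refine integral_congr_ae (ae_of_all _ fun y => ?_)
  simp only [smul_eq_mul]
  ring

theorem integral_compensated_abs_rpow {α γ : ℝ} (hα : α ∈ Ioo (1:ℝ) 2)
    (hγ : γ ∈ Ioo (α - 1) α) :
    ∫ y : ℝ, (|1 + y| ^ γ - 1 - γ * y) / |y| ^ (α + 1) =
      √Real.pi * Real.Gamma ((γ + 1) / 2) /
        (Real.Gamma ((γ - α + 1) / 2) * Real.Gamma ((α + 1) / 2)) *
      (γ / α * (Real.Gamma (1 - α / 2) * Real.Gamma ((α - γ) / 2) / Real.Gamma (1 - γ / 2))) := by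
  obtain ⟨-, hI⟩ := integrable_and_integral_symmIncrement_one hα hγ
  have hprod := integrable_symmIncrement_prod hα hγ
  obtain ⟨hα1, hα2⟩ := hα
  obtain ⟨hγ1, hγ2⟩ := hγ
  let H : ℝ → ℝ := fun y => ∫ x, symmIncrement γ x y ∂(gaussianReal 0 1)
  have hH : StronglyMeasurable H :=
    (measurable_symmIncrement γ).stronglyMeasurable.integral_prod_left'
  have hHw : ∀ y, ∫ x, symmIncrement γ x y * (|y| ^ (α + 1))⁻¹ ∂(gaussianReal 0 1) =
      H y * (|y| ^ (α + 1))⁻¹ := fun y => integral_mul_const _ _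
  have hHi : Integrable (fun y => H y * (|y| ^ (α + 1))⁻¹) :=
    hprod.integral_prod_right.congr (ae_of_all _ hHw)
  have h1 := integral_integral_symmIncrement (α := α) (γ := γ)
  rw [integral_integral_swap hprod, hI] at h1
  simp_rw [hHw] at h1
  have h2 := integral_mul_inv_abs_rpow_eq (by linarith) hH hHi
  have h3 : ∀ t ∈ Ioi (0:ℝ),
      t ^ (α / 2 - 1) * ∫ y, H y ∂(gaussianReal 0 (Real.toNNReal t⁻¹)) =
      (∫ x, |x| ^ γ ∂(gaussianReal 0 1)) * (t ^ (α / 2 - 1) * ((1 + t⁻¹) ^ (γ / 2) - 1)) := by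
    intro t ht
    simp only [H]
    rw [integral_symmIncrement_gaussianReal (by linarith),
      Real.coe_toNNReal _ (inv_pos.2 ht).le]
    ring
  rw [setIntegral_congr_fun measurableSet_Ioi h3, integral_const_mul,
    integral_rpow_mul_one_add_inv_rpow_sub_one (by linarith) (by linarith) (by linarith), h1,
    integral_abs_rpow_gaussianReal one_ne_zero (by linarith),
    integral_abs_rpow_gaussianReal one_ne_zero (by linarith)] at h2
  have g1 := Real.Gamma_pos_of_pos (by linarith : 0 < (γ - α + 1) / 2)
  have g2 := Real.Gamma_pos_of_pos (by linarith : 0 < (α + 1) / 2)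
  have g3 := Real.Gamma_pos_of_pos (by linarith : 0 < 1 - γ / 2)
  have e1 : (2:ℝ) ^ (γ / 2) = 2 ^ ((γ - α) / 2) * 2 ^ (α / 2) := by
    rw [← Real.rpow_add two_pos]; congr 1; ring
  have e2 : α / 2 - γ / 2 = (α - γ) / 2 := by ring
  have e3 : γ / 2 / (α / 2) = γ / α := by field_simp
  have p1 : (0:ℝ) < 2 ^ ((γ - α) / 2) := by positivity
  have p2 : (0:ℝ) < 2 ^ (α / 2) := by positivity
  rw [NNReal.coe_one, mul_one, e1, e2, e3] at h2
  generalize (∫ y : ℝ, (|1 + y| ^ γ - 1 - γ * y) / |y| ^ (α + 1)) = I at h2 ⊢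
  have hπ : 0 < √Real.pi := by positivity
  have hα0 : α ≠ 0 := by linarith
  field_simp at h2 ⊢
  linarith

theorem Gamma_one_sub_mul_cos_mul {α : ℝ} (hα : α ∈ Ioo (1:ℝ) 2) :
    Real.Gamma (1 - α) * Real.cos (α * Real.pi / 2) * (2 ^ α * Real.Gamma ((α + 1) / 2)) =
      √Real.pi * Real.Gamma (1 - α / 2) := by
  obtain ⟨hα1, hα2⟩ := hα
  have hdup := Real.Gamma_mul_Gamma_add_half ((1 - α) / 2)
  have hrefl := Real.Gamma_mul_Gamma_one_sub ((α + 1) / 2)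
  have hsin : Real.sin (Real.pi * ((α + 1) / 2)) = Real.cos (α * Real.pi / 2) := by
    rw [show Real.pi * ((α + 1) / 2) = α * Real.pi / 2 + Real.pi / 2 by ring,
      Real.sin_add_pi_div_two]
  have hcos : Real.cos (α * Real.pi / 2) < 0 :=
    Real.cos_neg_of_pi_div_two_lt_of_lt (by nlinarith [Real.pi_pos]) (by nlinarith [Real.pi_pos])
  rw [hsin, eq_div_iff hcos.ne, show 1 - (α + 1) / 2 = (1 - α) / 2 by ring] at hrefl
  rw [show (1 - α) / 2 + 1 / 2 = 1 - α / 2 by ring, show 2 * ((1 - α) / 2) = 1 - α by ring,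
    show 1 - (1 - α) = α by ring] at hdup
  have hne : Real.Gamma ((1 - α) / 2) ≠ 0 := fun h => by
    rw [h] at hrefl; simp at hrefl; exact Real.pi_ne_zero hrefl.symm
  apply mul_left_cancel₀ hne
  have hs : √Real.pi * √Real.pi = Real.pi := Real.mul_self_sqrt Real.pi_pos.le
  linear_combination (Real.Gamma (1 - α) * 2 ^ α) * hrefl - √Real.pi * hdup
    - (Real.Gamma (1 - α) * 2 ^ α) * hs

theorem stableMoment_div {α γ : ℝ} (hα : α ∈ Ioo (1:ℝ) 2) (hγ : γ ∈ Ioo (α - 1) α) :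
    γ / α * stableMoment α γ / stableMoment α (γ - α) =
      γ * 2 ^ α / 2 * Real.Gamma ((γ + 1) / 2) * Real.Gamma ((α - γ) / 2) /
        (Real.Gamma ((γ - α + 1) / 2) * Real.Gamma (1 - γ / 2)) := by
  obtain ⟨hα1, hα2⟩ := hα
  obtain ⟨hγ1, hγ2⟩ := hγ
  have hα0 : 0 < α := by linarith
  have hd : 0 < α - γ := by linarith
  have e1 : (α - (γ - α)) / α = (α - γ) / α + 1 := by field_simp; ring
  have e2 : (2 - (γ - α)) / 2 = (α - γ) / 2 + 1 := by ring
  have hq : 0 < (α - γ) / α := by positivity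
  unfold stableMoment
  rw [e1, e2, Real.Gamma_add_one hq.ne', Real.Gamma_add_one (by positivity : (α - γ) / 2 ≠ 0),
    Real.rpow_sub two_pos, show (1 + γ) / 2 = (γ + 1) / 2 by ring,
    show (1 + (γ - α)) / 2 = (γ - α + 1) / 2 by ring, show (2 - γ) / 2 = 1 - γ / 2 by ring]
  have g1 := Real.Gamma_pos_of_pos (by linarith : 0 < (γ - α + 1) / 2)
  have g2 := Real.Gamma_pos_of_pos hq
  have g3 := Real.Gamma_pos_of_pos (by linarith : 0 < 1 - γ / 2)
  have g4 := Real.Gamma_pos_of_pos (by linarith : 0 < (α - γ) / 2)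
  have hπ : 0 < √Real.pi := by positivity
  field_simp

theorem stable_constant_c3 (α γ : ℝ) (hα : α ∈ Set.Ioo (1:ℝ) 2)
    (hγ : γ ∈ Set.Ioo (α - 1) α) :
    Integrable (fun y : ℝ => (|1 + y| ^ γ - 1 - γ * y) / |y| ^ (α + 1)) ∧
      (α / (2 * Real.Gamma (1 - α) * Real.cos (α * Real.pi / 2))) *
          ∫ y : ℝ, (|1 + y| ^ γ - 1 - γ * y) / |y| ^ (α + 1) =
        (γ / α) * stableMoment α γ / stableMoment α (γ - α) := by
  refine ⟨integrable_compensated_abs_rpow hα hγ, ?_⟩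
  rw [stableMoment_div hα hγ, integral_compensated_abs_rpow hα hγ]
  have hc := Gamma_one_sub_mul_cos_mul hα
  obtain ⟨hα1, hα2⟩ := hα
  obtain ⟨hγ1, hγ2⟩ := hγ
  have g1 := Real.Gamma_pos_of_pos (by linarith : 0 < (γ - α + 1) / 2)
  have g2 := Real.Gamma_pos_of_pos (by linarith : 0 < (α + 1) / 2)
  have g3 := Real.Gamma_pos_of_pos (by linarith : 0 < 1 - γ / 2)
  have g5 := Real.Gamma_pos_of_pos (by linarith : 0 < 1 - α / 2)
  have hπ : 0 < √Real.pi := by positivity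
  have hne : Real.Gamma (1 - α) * Real.cos (α * Real.pi / 2) ≠ 0 := fun h => by
    rw [h, zero_mul] at hc
    have : 0 < √Real.pi * Real.Gamma (1 - α / 2) := by positivity
    linarith
  have hα0 : α ≠ 0 := by linarith
  have hconst : α / (2 * Real.Gamma (1 - α) * Real.cos (α * Real.pi / 2)) =
      α * (2 ^ α * Real.Gamma ((α + 1) / 2)) / (2 * (√Real.pi * Real.Gamma (1 - α / 2))) := by
    rw [← hc, mul_assoc 2]
    have : (2 : ℝ) ^ α * Real.Gamma ((α + 1) / 2) ≠ 0 := by positivity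
    generalize (2 : ℝ) ^ α * Real.Gamma ((α + 1) / 2) = X at *
    generalize Real.Gamma (1 - α) * Real.cos (α * Real.pi / 2) = Y at *
    field_simp
  rw [hconst]
  field_simp
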